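/- arXiv:2011.15010 — 2 statements merged into one kernel-verified Lean document; each statement's English description precedes it below -/
import Mathlib

section
/- The maximum size of a subset of {1,2,3}³ that does not contain all eight corners of any axis-parallel rectangular box is 22. Equivalently, the minimum number of points one must remove from {1,2,3}³ so that every axis-parallel box has at least one removed corner is 5. -/
def BoxFree (N : ℕ) (A : Finset (Fin N × Fin N × Fin N)) : Prop :=
  ¬ ∃ i1 i2 j1 j2 k1 k2 : Fin N, i1 < i2 ∧ j1 < j2 ∧ k1 < k2 ∧
      (i1, j1, k1) ∈ A ∧ (i1, j1, k2) ∈ A ∧ (i1, j2, k1) ∈ A ∧ (i1, j2, k2) ∈ A ∧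
      (i2, j1, k1) ∈ A ∧ (i2, j1, k2) ∈ A ∧ (i2, j2, k1) ∈ A ∧ (i2, j2, k2) ∈ A

def HitsAllBoxes (N : ℕ) (R : Finset (Fin N × Fin N × Fin N)) : Prop :=
  ∀ i1 i2 j1 j2 k1 k2 : Fin N, i1 < i2 → j1 < j2 → k1 < k2 →
    ((i1, j1, k1) ∈ R ∨ (i1, j1, k2) ∈ R ∨ (i1, j2, k1) ∈ R ∨ (i1, j2, k2) ∈ R ∨
     (i2, j1, k1) ∈ R ∨ (i2, j1, k2) ∈ R ∨ (i2, j2, k1) ∈ R ∨ (i2, j2, k2) ∈ R)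

theorem boxFree_iff_hitsAllBoxes_compl {N : ℕ} (A : Finset (Fin N × Fin N × Fin N)) :
    BoxFree N A ↔ HitsAllBoxes N Aᶜ := by
  simp only [BoxFree, HitsAllBoxes, Finset.mem_compl]
  push Not
  simp only [imp_iff_not_or]

/-- At most four points of the grid can be covered by three axis-orthogonal planes, one in each
direction. -/
theorem exists_planes_cover_of_card_le_four (R : Finset (Fin 3 × Fin 3 × Fin 3))
    (hR : R.card ≤ 4) :
    ∃ a b c : Fin 3, ∀ p ∈ R, p.1 = a ∨ p.2.1 = b ∨ p.2.2 = c := by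
  obtain ⟨S, hRS, hS⟩ := Finset.exists_superset_card_eq hR (by simp)
  obtain ⟨p, hp, q, hq, hpq, h⟩ : ∃ p ∈ S, ∃ q ∈ S, p ≠ q ∧ p.1 = q.1 :=
    Finset.exists_ne_map_eq_of_card_lt_of_maps_to (t := Finset.univ) (by simp [hS]) (by simp)
  have hcard : ((S.erase p).erase q).card = 2 := by
    rw [Finset.card_erase_of_mem (Finset.mem_erase.2 ⟨hpq.symm, hq⟩),
      Finset.card_erase_of_mem hp, hS]
  obtain ⟨r, s, -, hrs⟩ := Finset.card_eq_two.1 hcard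
  refine ⟨p.1, r.2.1, s.2.2, fun x hx => ?_⟩
  by_cases hxp : x = p
  · simp [hxp]
  by_cases hxq : x = q
  · simp [hxq, h]
  have hmem : x ∈ (S.erase p).erase q := by simp [hxp, hxq, hRS hx]
  rw [hrs, Finset.mem_insert, Finset.mem_singleton] at hmem
  rcases hmem with rfl | rfl <;> simp

theorem five_le_card_of_hitsAllBoxes {R : Finset (Fin 3 × Fin 3 × Fin 3)}
    (hR : HitsAllBoxes 3 R) : 5 ≤ R.card := by
  by_contra! hlt
  obtain ⟨a, b, c, h⟩ := exists_planes_cover_of_card_le_four R (by omega)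
  have avoid : ∀ a : Fin 3, ∃ i j : Fin 3, i < j ∧ i ≠ a ∧ j ≠ a := by decide
  obtain ⟨i1, i2, hi, hi1, hi2⟩ := avoid a
  obtain ⟨j1, j2, hj, hj1, hj2⟩ := avoid b
  obtain ⟨k1, k2, hk, hk1, hk2⟩ := avoid c
  rcases hR i1 i2 j1 j2 k1 k2 hi hj hk with h' | h' | h' | h' | h' | h' | h' | h' <;>
    simpa [*] using h _ h'

set_option synthInstance.maxSize 1000 in
theorem exists_hitsAllBoxes_card_eq_five :
    ∃ R : Finset (Fin 3 × Fin 3 × Fin 3), HitsAllBoxes 3 R ∧ R.card = 5 := by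
  refine ⟨{(0, 0, 0), (0, 1, 1), (1, 0, 1), (1, 1, 0), (2, 2, 2)}, ?_, by decide⟩
  unfold HitsAllBoxes
  decide +kernel

theorem order_of_three_grid :
    IsGreatest {m : ℕ | ∃ A : Finset (Fin 3 × Fin 3 × Fin 3), BoxFree 3 A ∧ A.card = m} 22 ∧
    IsLeast {m : ℕ | ∃ R : Finset (Fin 3 × Fin 3 × Fin 3), HitsAllBoxes 3 R ∧ R.card = m} 5 := by
  refine ⟨⟨?_, ?_⟩, exists_hitsAllBoxes_card_eq_five, ?_⟩
  · obtain ⟨R, hR, hcard⟩ := exists_hitsAllBoxes_card_eq_five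
    refine ⟨Rᶜ, ?_, by simp [Finset.card_compl, hcard]⟩
    rwa [boxFree_iff_hitsAllBoxes_compl, compl_compl]
  · rintro m ⟨A, hA, rfl⟩
    have h := five_le_card_of_hitsAllBoxes ((boxFree_iff_hitsAllBoxes_compl A).1 hA)
    have h' := A.card_add_card_compl
    simp only [Fintype.card_prod, Fintype.card_fin] at h'
    omega
  · rintro m ⟨R, hR, rfl⟩
    exact five_le_card_of_hitsAllBoxes hR
end

section
/- Let k ≥ 2 and n = 2k. If A is an n×n {0,1}-matrix with exactly 3k+1 ones such that every k×k minor contains a 1, then A is unique up to permutations of rows and columns: it is equivalent to the block matrix with identity I_{k-1} in the top-left corner and the tridiagonal-type (k+1)×(k+1) block B (with 1's at (1,1),(1,2),(k+1,k),(k+1,k+1) and (j,j±1) for 2 ≤ j ≤ k) in the bottom-right. -/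
/-- Every k×k minor (choice of k rows and k columns) of `A` contains a 1. -/
def MinorHit (n k : ℕ) (A : Fin n → Fin n → Bool) : Prop :=
  ∀ S T : Finset (Fin n), S.card = k → T.card = k → ∃ i ∈ S, ∃ j ∈ T, A i j = true

/-- The number of entries of `A` equal to 1. -/
def onesCount {n : ℕ} (A : Fin n → Fin n → Bool) : ℕ :=
  (Finset.univ.filter fun p : Fin n × Fin n => A p.1 p.2 = true).card

/-- Block-diagonal matrix: identity `I_{k-1}` in the top-left, and in the bottom-right
the `(k+1)×(k+1)` block `B` with 1's exactly at (0-indexed) positions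
`(0,0),(0,1),(k,k-1),(k,k)` and `(r,r-1),(r,r+1)` for `1 ≤ r ≤ k-1`. -/
def blockMatrix (k : ℕ) : Fin (2 * k) → Fin (2 * k) → Bool :=
  fun i j =>
    decide ((i.val < k - 1 ∧ i = j) ∨
      (k - 1 ≤ i.val ∧ k - 1 ≤ j.val ∧
        ((i.val - (k - 1)) + 1 = j.val - (k - 1) ∨
         (j.val - (k - 1)) + 1 = i.val - (k - 1) ∨
         (i.val = k - 1 ∧ j.val = k - 1) ∨
         (i.val = 2 * k - 1 ∧ j.val = 2 * k - 1))))

theorem Finset.pairwiseDisjoint_of_sum_card_le_card_biUnion {ι α : Type*} [DecidableEq ι]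
    [DecidableEq α] {S : Finset ι} {N : ι → Finset α}
    (h : ∑ i ∈ S, (N i).card ≤ (S.biUnion N).card) : (S : Set ι).PairwiseDisjoint N := by
  intro i hi j hj hij
  have hU : S.biUnion N = N i ∪ (S.erase i).biUnion N := by
    rw [← Finset.biUnion_insert, Finset.insert_erase hi]
  have hle := Finset.card_biUnion_le (s := S.erase i) (t := N)
  have hsum := Finset.add_sum_erase S (fun i => (N i).card) hi
  have hcard := Finset.card_union_add_card_inter (N i) ((S.erase i).biUnion N)
  rw [hU] at h
  have hinter : (N i ∩ (S.erase i).biUnion N).card = 0 := by omega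
  have hdisj : Disjoint (N i) ((S.erase i).biUnion N) :=
    Finset.disjoint_iff_inter_eq_empty.2 (Finset.card_eq_zero.1 hinter)
  exact hdisj.mono_right
    (Finset.subset_biUnion_of_mem N (Finset.mem_erase.2 ⟨hij.symm, hj⟩))

section Neighborhoods

variable {ι α : Type*} [Fintype ι] [DecidableEq ι] [DecidableEq α]
  {k : ℕ} {N : ι → Finset α}

omit [DecidableEq ι] in
theorem card_filter_card_le_one_lt
    (hN : ∀ S : Finset ι, S.card = k → k < (S.biUnion N).card) :
    (Finset.univ.filter fun i => (N i).card ≤ 1).card < k := by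
  by_contra! h
  obtain ⟨S, hSL, hS⟩ := Finset.exists_subset_card_eq h
  have hle := Finset.card_biUnion_le_card_mul S N 1
    fun i hi => (Finset.mem_filter.1 (hSL hi)).2
  have := hN S hS
  omega

theorem sum_card_eq_of_filter_subset (hι : Fintype.card ι = 2 * k)
    (hN : ∀ S : Finset ι, S.card = k → k < (S.biUnion N).card)
    (hsum : ∑ i, (N i).card = 3 * k + 1) {S : Finset ι}
    (hS : (Finset.univ.filter fun i => (N i).card ≤ 1) ⊆ S) (hSk : S.card = k) :
    ∑ i ∈ S, (N i).card = k + 1 ∧ ∀ i ∉ S, (N i).card = 2 := by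
  have h2 : ∀ i ∈ Sᶜ, 2 ≤ (N i).card := by
    intro i hi
    by_contra! h
    exact Finset.mem_compl.1 hi (hS (Finset.mem_filter.2 ⟨Finset.mem_univ i, by omega⟩))
  have hsplit := Finset.sum_add_sum_compl S fun i => (N i).card
  have hlow := (hN S hSk).trans_le Finset.card_biUnion_le
  have hcompl : Sᶜ.card = k := by rw [Finset.card_compl]; omega
  have hhigh : ∑ _i ∈ Sᶜ, 2 ≤ ∑ i ∈ Sᶜ, (N i).card := Finset.sum_le_sum h2
  have hconst : ∑ _i ∈ Sᶜ, 2 = k * 2 := by rw [Finset.sum_const, hcompl, smul_eq_mul]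
  refine ⟨by omega, fun i hi => ?_⟩
  have heq : ∑ _i ∈ Sᶜ, 2 = ∑ i ∈ Sᶜ, (N i).card := by omega
  exact ((Finset.sum_eq_sum_iff_of_le h2).1 heq i (Finset.mem_compl.2 hi)).symm

theorem card_le_two_of_sum_card_eq (hι : Fintype.card ι = 2 * k)
    (hN : ∀ S : Finset ι, S.card = k → k < (S.biUnion N).card)
    (hsum : ∑ i, (N i).card = 3 * k + 1) (i : ι) : (N i).card ≤ 2 := by
  by_contra! hi
  have hL := card_filter_card_le_one_lt hN
  obtain ⟨S, hLS, hSi, hSk⟩ := Finset.exists_subsuperset_card_eq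
    (s := Finset.univ.filter fun i => (N i).card ≤ 1) (t := Finset.univ.erase i) (n := k)
    (fun j hj => Finset.mem_erase.2 ⟨by rintro rfl; simp at hj; omega, Finset.mem_univ j⟩)
    hL.le (by rw [Finset.card_erase_of_mem (Finset.mem_univ i), Finset.card_univ]; omega)
  have := (sum_card_eq_of_filter_subset hι hN hsum hLS hSk).2 i
    fun h => (Finset.mem_erase.1 (hSi h)).1 rfl
  omega

theorem exists_isolated_of_sum_card_eq [Fintype α] (hι : Fintype.card ι = 2 * k)
    (hα : Fintype.card α = 2 * k)
    (hN : ∀ S : Finset ι, S.card = k → k < (S.biUnion N).card)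
    (hsum : ∑ i, (N i).card = 3 * k + 1) :
    ∃ L : Finset ι, L.card + 1 = k ∧ (∀ i ∈ L, (N i).card = 1) ∧ (∀ i ∉ L, (N i).card = 2) ∧
      ∀ i ∈ L, ∀ j, i ≠ j → Disjoint (N i) (N j) := by
  have hLk := card_filter_card_le_one_lt hN
  have hle2 := card_le_two_of_sum_card_eq hι hN hsum
  set L := Finset.univ.filter fun i => (N i).card ≤ 1 with hLdef
  have hmem : ∀ i, i ∈ L ↔ (N i).card ≤ 1 := by simp [hLdef]
  have h2 : ∀ i ∉ L, (N i).card = 2 := fun i hi => by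
    have := hle2 i
    rw [hmem] at hi
    omega
  have hdisj : ∀ S, L ⊆ S → S.card ≤ k → (S : Set ι).PairwiseDisjoint N := by
    intro S hLS hS
    obtain ⟨T, hST, -, hT⟩ := Finset.exists_subsuperset_card_eq (Finset.subset_univ S) hS
      (by rw [Finset.card_univ]; omega)
    have hTs := (sum_card_eq_of_filter_subset hι hN hsum (hLS.trans hST) hT).1
    refine (Finset.pairwiseDisjoint_of_sum_card_le_card_biUnion (S := T) ?_).subset
      (Finset.coe_subset.2 hST)
    have := hN T hT
    omega
  have hL : L.card + 1 = k := by
    by_contra hne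
    have hpair : (Lᶜ : Finset ι).card * 2 ≤ 2 * k := by
      have hpd : ((Lᶜ : Finset ι) : Set ι).PairwiseDisjoint N := by
        intro i _ j _ hij
        refine hdisj (insert i (insert j L)) (fun x hx => by simp [hx]) ?_ (by simp) (by simp) hij
        have h₁ := Finset.card_insert_le i (insert j L)
        have h₂ := Finset.card_insert_le j L
        omega
      have hc := Finset.card_biUnion hpd
      rw [Finset.sum_congr rfl fun i hi => h2 i (Finset.mem_compl.1 hi), Finset.sum_const,
        smul_eq_mul] at hc
      rw [← hc, ← hα]
      exact Finset.card_le_univ _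
    rw [Finset.card_compl] at hpair
    omega
  have hsumL : ∑ i ∈ L, (N i).card = L.card := by
    obtain ⟨T, hLT, -, hT⟩ := Finset.exists_subsuperset_card_eq (Finset.subset_univ L) hLk.le
      (by rw [Finset.card_univ]; omega)
    have hTs := (sum_card_eq_of_filter_subset hι hN hsum hLT hT).1
    have hsplit := Finset.sum_sdiff (f := fun i => (N i).card) hLT
    rw [Finset.sum_congr rfl fun i hi => h2 i (Finset.mem_sdiff.1 hi).2, Finset.sum_const,
      smul_eq_mul, Finset.card_sdiff_of_subset hLT] at hsplit
    omega
  refine ⟨L, hL, fun i hi => ?_, h2, fun i hi j hij => ?_⟩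
  · refine (Finset.sum_eq_sum_iff_of_le (g := fun _ => 1) fun i hi => (hmem i).1 hi).1 ?_ i hi
    rw [hsumL, Finset.sum_const, smul_eq_mul, mul_one]
  · refine hdisj (insert j L) (Finset.subset_insert j L) ?_ (by simp [hi]) (by simp) hij
    have := Finset.card_insert_le j L
    omega

theorem exists_cyclic_enumeration {m : ℕ} (hm : Fintype.card ι = m) (hpos : 0 < m)
    (h2 : ∀ i, (N i).card = 2)
    (hcol : ∀ c i₁ i₂ i₃, c ∈ N i₁ → c ∈ N i₂ → c ∈ N i₃ → i₁ = i₂ ∨ i₁ = i₃ ∨ i₂ = i₃)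
    (hexp : ∀ S : Finset ι, S.Nonempty → S.card < m → S.card < (S.biUnion N).card)
    (huniv : (Finset.univ.biUnion N).card = m) :
    ∃ (r : ℕ → ι) (c : ℕ → α), (∀ p q, p < m → q < m → r p = r q → p = q) ∧
      (∀ p q, p < m → q < m → c p = c q → p = q) ∧ c m = c 0 ∧
      ∀ p, N (r p) = {c p, c (p + 1)} := by
  obtain ⟨f, hf, hfN⟩ := (Finset.all_card_le_biUnion_card_iff_exists_injective N).1 fun S => by
    rcases S.eq_empty_or_nonempty with rfl | hne
    · simp
    · rcases (Finset.card_le_univ S).lt_or_eq with h | h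
      · exact (hexp S hne (hm ▸ h)).le
      · rw [Finset.card_eq_iff_eq_univ] at h
        rw [h, huniv, Finset.card_univ, hm]
  have himage : Finset.univ.image f = Finset.univ.biUnion N := by
    refine Finset.eq_of_subset_of_card_le ?_ ?_
    · intro c hc
      obtain ⟨i, -, rfl⟩ := Finset.mem_image.1 hc
      exact Finset.mem_biUnion.2 ⟨i, Finset.mem_univ i, hfN i⟩
    · rw [huniv, Finset.card_image_of_injective _ hf, Finset.card_univ, hm]
  have hnext : ∀ i, ∃ j, j ≠ i ∧ N i = {f i, f j} := by
    intro i
    obtain ⟨c, hc, hci⟩ := Finset.exists_mem_ne (by rw [h2 i]; norm_num) (f i)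
    obtain ⟨j, -, rfl⟩ := Finset.mem_image.1
      (himage ▸ Finset.mem_biUnion.2 ⟨i, Finset.mem_univ i, hc⟩)
    refine ⟨j, fun h => hci (h ▸ rfl), (Finset.eq_of_subset_of_card_le ?_ ?_).symm⟩
    · simp [Finset.insert_subset_iff, hfN, hc]
    · rw [h2, Finset.card_pair hci.symm]
  choose π hπ hNπ using hnext
  have hπinj : Function.Injective π := by
    intro i j hij
    have hi : f (π i) ∈ N i := by rw [hNπ i]; simp
    have hj : f (π i) ∈ N j := by rw [hij, hNπ j]; simp
    rcases hcol _ _ _ _ hi hj (hfN (π i)) with h | h | h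
    · exact h
    · exact absurd h.symm (hπ i)
    · exact absurd (hij ▸ h.symm) (hπ j)
  obtain ⟨x⟩ : Nonempty ι := Fintype.card_pos_iff.1 (hm ▸ hpos)
  have hper : 0 < Function.minimalPeriod π x :=
    Function.minimalPeriod_pos_of_mem_periodicPts (hπinj.mem_periodicPts x)
  have hinj : ∀ p q, p < Function.minimalPeriod π x → q < Function.minimalPeriod π x →
      π^[p] x = π^[q] x → p = q := fun p q hp hq h =>
    Function.iterate_injOn_Iio_minimalPeriod hp hq h
  have hperiod : Function.minimalPeriod π x = m := by
    set O := (Finset.range (Function.minimalPeriod π x)).image fun p => π^[p] x with hO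
    have hOcard : O.card = Function.minimalPeriod π x := by
      rw [hO, Finset.card_image_of_injOn, Finset.card_range]
      intro p hp q hq h
      exact hinj p q (by simpa using hp) (by simpa using hq) h
    have hOmem : ∀ p, π^[p] x ∈ O := fun p => Finset.mem_image.2
      ⟨p % _, Finset.mem_range.2 (Nat.mod_lt _ hper), Function.iterate_mod_minimalPeriod_eq⟩
    have hsub : O.biUnion N ⊆ O.image f := by
      refine Finset.biUnion_subset.2 fun i hi => ?_
      obtain ⟨p, -, rfl⟩ := Finset.mem_image.1 hi
      rw [hNπ, Finset.insert_subset_iff, Finset.singleton_subset_iff]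
      refine ⟨Finset.mem_image_of_mem f (hOmem p), Finset.mem_image_of_mem f ?_⟩
      simpa only [Function.iterate_succ_apply'] using hOmem (p + 1)
    have hle : (O.biUnion N).card ≤ O.card :=
      (Finset.card_le_card hsub).trans Finset.card_image_le
    rw [← hOcard]
    by_contra hne
    have hlt : O.card < m := lt_of_le_of_ne (hm ▸ Finset.card_le_univ O) hne
    have := hexp O ⟨_, hOmem 0⟩ hlt
    omega
  rw [hperiod] at hinj
  refine ⟨fun p => π^[p] x, fun p => f (π^[p] x), hinj,
    fun p q hp hq h => hinj p q hp hq (hf h), ?_, fun p => ?_⟩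
  · show f (π^[m] x) = f x
    rw [← hperiod, Function.iterate_minimalPeriod]
  · show N (π^[p] x) = {f (π^[p] x), f (π^[p + 1] x)}
    rw [hNπ, Function.iterate_succ_apply']

end Neighborhoods

theorem card_biUnion_of_minorHit {n k : ℕ} {A : Fin n → Fin n → Bool} (hn : n = 2 * k)
    (hA : MinorHit n k A) (S : Finset (Fin n)) (hS : S.card = k) :
    k < (S.biUnion fun i => Finset.univ.filter fun j => A i j = true).card := by
  by_contra! h
  obtain ⟨T, hT, hTk⟩ := Finset.exists_subset_card_eq (n := k)
    (s := (S.biUnion fun i => Finset.univ.filter fun j => A i j = true)ᶜ)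
    (by rw [Finset.card_compl, Fintype.card_fin]; omega)
  obtain ⟨i, hi, j, hj, hij⟩ := hA S T hS hTk
  exact Finset.mem_compl.1 (hT hj) (Finset.mem_biUnion.2 ⟨i, hi, by simpa using hij⟩)

theorem sum_card_eq_onesCount {n : ℕ} (A : Fin n → Fin n → Bool) :
    ∑ i, (Finset.univ.filter fun j => A i j = true).card = onesCount A := by
  simp only [onesCount, Finset.card_filter, Fintype.sum_prod_type]

theorem MinorHit.transpose {n k : ℕ} {A : Fin n → Fin n → Bool} (hA : MinorHit n k A) :
    MinorHit n k fun i j => A j i := fun S T hS hT => by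
  obtain ⟨i, hi, j, hj, h⟩ := hA T S hT hS
  exact ⟨j, hj, i, hi, h⟩

theorem onesCount_transpose {n : ℕ} (A : Fin n → Fin n → Bool) :
    onesCount (fun i j => A j i) = onesCount A := by
  simp only [← sum_card_eq_onesCount, Finset.card_filter]
  exact Finset.sum_comm

/-- The block `B` is a single cycle; `cycleRow k i` is the position along it of row `i`. -/
def cycleRow (k i : ℕ) : ℕ :=
  if i % 2 = 0 then i / 2 else k - i / 2

/-- The position of column `j` along the cycle `B`; row `p` meets columns `p` and `p + 1`. -/
def cycleCol (k j : ℕ) : ℕ :=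
  if j % 2 = 1 then (j + 1) / 2 else if j = 0 then 0 else k - j / 2 + 1

theorem cycleCol_eq_cycleRow_iff {k x y : ℕ} (hk : 2 ≤ k) (hx : x ≤ k) (hy : y ≤ k) :
    cycleCol k y = cycleRow k x ∨ cycleCol k y = cycleRow k x + 1 ∨
      cycleRow k x = k ∧ cycleCol k y = 0 ↔
    x + 1 = y ∨ y + 1 = x ∨ x = 0 ∧ y = 0 ∨ x = k ∧ y = k := by
  have hrow : x % 2 = 0 ∧ 2 * cycleRow k x = x ∨
      x % 2 = 1 ∧ 2 * cycleRow k x + x = 2 * k + 1 := by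
    unfold cycleRow
    split_ifs <;> omega
  have hcol : y % 2 = 1 ∧ 2 * cycleCol k y = y + 1 ∨ y = 0 ∧ cycleCol k y = 0 ∨
      0 < y ∧ y % 2 = 0 ∧ 2 * cycleCol k y + y = 2 * k + 2 := by
    unfold cycleCol
    split_ifs <;> omega
  generalize cycleRow k x = p at *
  generalize cycleCol k y = q at *
  rcases hrow with hrow | hrow <;> rcases hcol with hcol | hcol | hcol <;> constructor <;>
    intro h <;> omega

theorem exists_perm_eq_blockMatrix {k : ℕ} (hk : 2 ≤ k) {A : Fin (2 * k) → Fin (2 * k) → Bool}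
    {a u r c : ℕ → Fin (2 * k)}
    (ha : ∀ p q, p < k - 1 → q < k - 1 → a p = a q → p = q)
    (hu : ∀ p q, p < k - 1 → q < k - 1 → u p = u q → p = q)
    (hr : ∀ p q, p < k + 1 → q < k + 1 → r p = r q → p = q)
    (hc : ∀ p q, p < k + 1 → q < k + 1 → c p = c q → p = q)
    (har : ∀ p q, p < k - 1 → a p ≠ r q) (huc : ∀ p q, p < k - 1 → u p ≠ c q)
    (hper : c (k + 1) = c 0)
    (hAa : ∀ p j, p < k - 1 → (A (a p) j = true ↔ j = u p))
    (hAr : ∀ p j, A (r p) j = true ↔ j = c p ∨ j = c (p + 1)) :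
    ∃ σ τ : Equiv.Perm (Fin (2 * k)), ∀ i j, A (σ i) (τ j) = blockMatrix k i j := by
  have hrow : ∀ i, i ≤ k → cycleRow k i < k + 1 := fun i hi => by
    unfold cycleRow; split_ifs <;> omega
  have hcolumn : ∀ i, i ≤ k → cycleCol k i < k + 1 := fun i hi => by
    unfold cycleCol; split_ifs <;> omega
  let s : Fin (2 * k) → Fin (2 * k) := fun i =>
    if i.val < k - 1 then a i.val else r (cycleRow k (i.val - (k - 1)))
  let t : Fin (2 * k) → Fin (2 * k) := fun i =>
    if i.val < k - 1 then u i.val else c (cycleCol k (i.val - (k - 1)))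
  have hs : Function.Injective s := by
    intro i j hij
    have hi := i.isLt
    have hj := j.isLt
    apply Fin.ext
    simp only [s] at hij
    split_ifs at hij with h₁ h₂ h₂
    · exact ha _ _ h₁ h₂ hij
    · exact absurd hij (har _ _ h₁)
    · exact absurd hij.symm (har _ _ h₂)
    · have := hr _ _ (hrow _ (by omega)) (hrow _ (by omega)) hij
      unfold cycleRow at this
      split_ifs at this <;> omega
  have ht : Function.Injective t := by
    intro i j hij
    have hi := i.isLt
    have hj := j.isLt
    apply Fin.ext
    simp only [t] at hij
    split_ifs at hij with h₁ h₂ h₂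
    · exact hu _ _ h₁ h₂ hij
    · exact absurd hij (huc _ _ h₁)
    · exact absurd hij.symm (huc _ _ h₂)
    · have := hc _ _ (hcolumn _ (by omega)) (hcolumn _ (by omega)) hij
      unfold cycleCol at this
      split_ifs at this <;> omega
  have hcc : ∀ p q, p ≤ k → q ≤ k →
      (c q = c p ∨ c q = c (p + 1) ↔ q = p ∨ q = p + 1 ∨ p = k ∧ q = 0) := by
    intro p q hp hq
    constructor
    · rintro (h | h)
      · exact Or.inl (hc _ _ (by omega) (by omega) h)
      · rcases hp.lt_or_eq with hlt | rfl
        · exact Or.inr (Or.inl (hc _ _ (by omega) (by omega) h))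
        · exact Or.inr (Or.inr ⟨rfl, hc _ _ (by omega) (by omega) (h.trans hper)⟩)
    · rintro (rfl | rfl | ⟨rfl, rfl⟩)
      · exact Or.inl rfl
      · exact Or.inr rfl
      · exact Or.inr hper.symm
  refine ⟨Equiv.ofBijective s (Finite.injective_iff_bijective.1 hs),
    Equiv.ofBijective t (Finite.injective_iff_bijective.1 ht), fun i j => ?_⟩
  have hi := i.isLt
  have hj := j.isLt
  rw [Bool.eq_iff_iff]
  simp only [Equiv.ofBijective_apply, blockMatrix, decide_eq_true_eq, Fin.ext_iff (a := i)]
  by_cases hi' : i.val < k - 1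
  · simp only [s, if_pos hi', hAa _ _ hi', t]
    split_ifs with hj'
    · constructor
      · intro h
        exact Or.inl ⟨hi', (hu _ _ hj' hi' h).symm⟩
      · intro h
        have : j.val = i.val := by omega
        rw [this]
    · constructor
      · intro h
        exact absurd h.symm (huc _ _ hi')
      · intro h
        omega
  · simp only [s, if_neg hi', hAr, t]
    split_ifs with hj'
    · constructor
      · rintro (h | h) <;> exact absurd h (huc _ _ hj')
      · intro h
        omega
    · have hi₁ : i.val - (k - 1) ≤ k := by omega
      have hj₁ : j.val - (k - 1) ≤ k := by omega
      rw [hcc _ _ (Nat.lt_succ_iff.1 (hrow _ hi₁)) (Nat.lt_succ_iff.1 (hcolumn _ hj₁)),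
        cycleCol_eq_cycleRow_iff hk hi₁ hj₁]
      omega

theorem half_case_uniqueness (k : ℕ) (hk : 2 ≤ k)
    (A : Fin (2 * k) → Fin (2 * k) → Bool) (hA : MinorHit (2 * k) k A)
    (hcard : onesCount A = 3 * k + 1) :
    ∃ σ τ : Equiv.Perm (Fin (2 * k)), ∀ i j, A (σ i) (τ j) = blockMatrix k i j := by
  let N : Fin (2 * k) → Finset (Fin (2 * k)) := fun i => Finset.univ.filter fun j => A i j = true
  have hmemN : ∀ i j, j ∈ N i ↔ A i j = true := by simp [N]
  have hN : ∀ S : Finset (Fin (2 * k)), S.card = k → k < (S.biUnion N).card :=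
    card_biUnion_of_minorHit rfl hA
  obtain ⟨L, hLk, hL1, hL2, hdisj⟩ := exists_isolated_of_sum_card_eq (Fintype.card_fin _)
    (Fintype.card_fin _) hN ((sum_card_eq_onesCount A).trans hcard)
  have hcol := card_le_two_of_sum_card_eq (Fintype.card_fin _)
    (card_biUnion_of_minorHit rfl hA.transpose)
    ((sum_card_eq_onesCount _).trans ((onesCount_transpose A).trans hcard))
  have hιcard : Fintype.card {i // i ∉ L} = k + 1 := by
    rw [Fintype.card_subtype_compl, Fintype.card_fin, Fintype.card_coe]
    omega
  have hexp : ∀ S : Finset {i // i ∉ L}, S.Nonempty → S.card < k + 1 →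
      S.card < (S.biUnion fun i => N i).card := by
    intro S hS hSk
    have hSpos := hS.card_pos
    obtain ⟨M, hML, hM⟩ := Finset.exists_subset_card_eq (show k - S.card ≤ L.card by omega)
    have hdS : Disjoint (S.map (Function.Embedding.subtype _)) M := by
      rw [Finset.disjoint_left]
      intro x hx hxM
      obtain ⟨y, -, rfl⟩ := Finset.mem_map.1 hx
      exact y.2 (hML hxM)
    have h := hN (S.map (Function.Embedding.subtype _) ∪ M) (by
      rw [Finset.card_union_of_disjoint hdS, Finset.card_map]
      omega)
    have hM1 := Finset.card_biUnion_le_card_mul M N 1 fun i hi => (hL1 i (hML hi)).le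
    rw [Finset.union_biUnion, Finset.map_eq_image, Finset.image_biUnion] at h
    have hle := Finset.card_union_le (S.biUnion fun i => N i) (M.biUnion N)
    simp only [Function.Embedding.subtype_apply] at h
    omega
  have huniv : (Finset.univ.biUnion fun i : {i // i ∉ L} => N i).card = k + 1 := by
    apply le_antisymm
    · have hd : Disjoint (Finset.univ.biUnion fun i : {i // i ∉ L} => N i) (L.biUnion N) := by
        simp only [Finset.disjoint_biUnion_left, Finset.disjoint_biUnion_right]
        exact fun j hj i _ => (hdisj j hj i (ne_of_mem_of_not_mem hj i.2)).symm
      have hLcard : (L.biUnion N).card = L.card := by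
        rw [Finset.card_biUnion fun i hi j _ hij => hdisj i hi j hij, Finset.sum_congr rfl hL1]
        simp
      have hle := Finset.card_le_univ
        ((Finset.univ.biUnion fun i : {i // i ∉ L} => N i) ∪ L.biUnion N)
      rw [Finset.card_union_of_disjoint hd, Fintype.card_fin] at hle
      omega
    · obtain ⟨S, -, hS⟩ := Finset.exists_subset_card_eq (n := k)
        (s := (Finset.univ : Finset {i // i ∉ L})) (by rw [Finset.card_univ]; omega)
      have h₁ := hexp S (Finset.card_pos.1 (by omega)) (by omega)
      have h₂ := Finset.card_le_card (Finset.biUnion_subset_biUnion_of_subset_left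
        (fun i : {i // i ∉ L} => N i) (Finset.subset_univ S))
      omega
  obtain ⟨r, c, hr, hc, hper, hrc⟩ := exists_cyclic_enumeration hιcard (Nat.succ_pos k)
    (fun i => hL2 i i.2) (fun x i₁ i₂ i₃ h₁ h₂ h₃ => by
      by_contra! h
      refine absurd (hcol x) (not_le.2 (Finset.two_lt_card.2 ⟨i₁.1, ?_, i₂.1, ?_, i₃.1, ?_,
        Subtype.coe_ne_coe.2 h.1, Subtype.coe_ne_coe.2 h.2.1, Subtype.coe_ne_coe.2 h.2.2⟩))
      · simpa using (hmemN _ x).1 h₁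
      · simpa using (hmemN _ x).1 h₂
      · simpa using (hmemN _ x).1 h₃) hexp huniv
  have hiso : ∀ i, ∃ j, i ∈ L → N i = {j} := fun i => by
    by_cases hi : i ∈ L
    · obtain ⟨j, hj⟩ := Finset.card_eq_one.1 (hL1 i hi)
      exact ⟨j, fun _ => hj⟩
    · exact ⟨i, fun h => absurd h hi⟩
  choose v hv using hiso
  let e : Fin (k - 1) ≃ L := (L.equivFinOfCardEq (by omega)).symm
  let a : ℕ → Fin (2 * k) := fun p => if h : p < k - 1 then e ⟨p, h⟩ else ⟨0, by omega⟩
  have hae : ∀ p (h : p < k - 1), a p = e ⟨p, h⟩ := fun p h => dif_pos h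
  have haL : ∀ p, p < k - 1 → a p ∈ L := fun p h => hae p h ▸ (e ⟨p, h⟩).2
  have ha : ∀ p q, p < k - 1 → q < k - 1 → a p = a q → p = q := by
    intro p q hp hq h
    rw [hae p hp, hae q hq] at h
    exact congrArg Fin.val (e.injective (Subtype.ext h))
  have hva : ∀ p, p < k - 1 → v (a p) ∈ N (a p) := fun p hp => by rw [hv _ (haL p hp)]; simp
  refine exists_perm_eq_blockMatrix hk (a := a) (u := fun p => v (a p)) (r := fun p => r p)
    (c := c) ha ?_ (fun p q hp hq h => hr p q hp hq (Subtype.ext h)) hc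
    (fun p q hp => ne_of_mem_of_not_mem (haL p hp) (r q).2) ?_ hper ?_ ?_
  · intro p q hp hq h
    by_contra hpq
    exact Finset.disjoint_left.1
      (hdisj _ (haL p hp) (a q) fun h' => hpq (ha p q hp hq h')) (hva p hp)
      (by simpa only [h] using hva q hq)
  · intro p q hp h
    refine Finset.disjoint_left.1
      (hdisj _ (haL p hp) (r q) (ne_of_mem_of_not_mem (haL p hp) (r q).2)) (hva p hp) ?_
    rw [hrc q]
    simp [h]
  · intro p j hp
    rw [← hmemN, hv _ (haL p hp), Finset.mem_singleton]
  · intro p j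
    rw [← hmemN, hrc p, Finset.mem_insert, Finset.mem_singleton]
end
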